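/- Let K/ℚ be a cyclic Galois extension of degree 6 and let F be the intermediate field with [F:ℚ] = 3. Assume that the class number h_K is relatively prime to 6 and that 3 does not divide |Aut(Cl(K))|. Then the exponent of the class group Cl(F) is at most 2; consequently, there exists an integer s ≥ 0 such that Cl(F) ≅ (ℤ/2ℤ)^s. -/

import Mathlib

open NumberField
open scoped nonZeroDivisors Pointwise

/-- A ring isomorphism induces a homomorphism on class groups, given by mapping ideals. -/
theorem ClassGroup.exists_hom_mk0 {R S : Type*} [CommRing R] [IsDedekindDomain R] [CommRing S]
    [IsDedekindDomain S] (f : R ≃+* S) :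
    ∃ φ : ClassGroup R →* ClassGroup S, ∀ (I : (Ideal R)⁰) (J : (Ideal S)⁰),
      (I : Ideal R).map (f : R →+* S) = J → φ (ClassGroup.mk0 I) = ClassGroup.mk0 J := by
  algebraize [(f : R →+* S)]
  have : FaithfulSMul R S := (faithfulSMul_iff_algebraMap_injective R S).2 f.injective
  refine ⟨ClassGroup.extendedHom R S, fun I J h ↦ ?_⟩
  rw [ClassGroup.extendedHom_mk0]
  exact congrArg _ (Subtype.ext h)

theorem Ideal.smul_mem_nonZeroDivisors {G R : Type*} [Group G] [CommRing R] [IsDedekindDomain R]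
    [MulSemiringAction G R] (g : G) (I : (Ideal R)⁰) : g • (I : Ideal R) ∈ (Ideal R)⁰ := by
  rw [mem_nonZeroDivisors_iff_ne_zero]
  intro h
  refine nonZeroDivisors.coe_ne_zero I ?_
  rw [← inv_smul_smul g (I : Ideal R), h, smul_zero]

/-- A group acting on a Dedekind domain acts on its class group. -/
theorem ClassGroup.exists_hom_mulAut (G R : Type*) [Group G] [CommRing R] [IsDedekindDomain R]
    [MulSemiringAction G R] :
    ∃ φ : G →* MulAut (ClassGroup R), ∀ (g : G) (I J : (Ideal R)⁰),
      g • (I : Ideal R) = J → φ g (ClassGroup.mk0 I) = ClassGroup.mk0 J := by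
  choose ψ hψ using fun g : G ↦ ClassGroup.exists_hom_mk0 (MulSemiringAction.toRingEquiv G R g)
  replace hψ (g : G) (I : (Ideal R)⁰) : ψ g (ClassGroup.mk0 I) =
      ClassGroup.mk0 ⟨g • (I : Ideal R), Ideal.smul_mem_nonZeroDivisors g I⟩ := hψ g _ _ rfl
  let : MulDistribMulAction G (ClassGroup R) :=
    { smul g x := ψ g x
      one_smul x := by
        obtain ⟨I, rfl⟩ := ClassGroup.mk0_surjective x
        exact (hψ 1 I).trans (congrArg _ (Subtype.ext (one_smul G (I : Ideal R))))
      mul_smul g h x := by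
        obtain ⟨I, rfl⟩ := ClassGroup.mk0_surjective x
        change ψ (g * h) _ = ψ g (ψ h _)
        rw [hψ, hψ, hψ]
        exact congrArg _ (Subtype.ext (mul_smul g h (I : Ideal R)))
      smul_mul g x y := map_mul (ψ g) x y
      smul_one g := map_one (ψ g) }
  exact ⟨MulDistribMulAction.toMulAut G (ClassGroup R), fun g I J h ↦
    (hψ g I).trans (congrArg _ (Subtype.ext h))⟩

theorem Ideal.absNorm_galois_smul {K : Type*} [Field K] [NumberField K] (g : K ≃ₐ[ℚ] K)
    (I : Ideal (𝓞 K)) : (g • I).absNorm = I.absNorm := by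
  have h := Ideal.relNorm_smul (R := ℤ) g I
  rw [Ideal.relNorm_int, Ideal.relNorm_int] at h
  simpa using congrArg Ideal.absNorm h

/-- In a Galois number field the product of the conjugates of an ideal is generated by its norm. -/
theorem Ideal.prod_galois_smul {K : Type*} [Field K] [NumberField K] [IsGalois ℚ K]
    (I : Ideal (𝓞 K)) (hI : I ≠ ⊥) :
    ∏ g : K ≃ₐ[ℚ] K, g • I = Ideal.span {(I.absNorm : 𝓞 K)} := by
  have hmap : (Ideal.relNorm ℤ I).map (algebraMap ℤ (𝓞 K)) =
      Ideal.span {(I.absNorm : 𝓞 K)} := by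
    rw [Ideal.relNorm_int, Ideal.map_span, Set.image_singleton]
    simp
  have hle : Ideal.span {(I.absNorm : 𝓞 K)} ≤ ∏ g : K ≃ₐ[ℚ] K, g • I := by
    rw [← hmap, Ideal.map_relNorm, Ideal.span_le]
    rintro _ ⟨x, hx, rfl⟩
    have hprod : algebraMap ℤ (𝓞 K) (Algebra.intNorm ℤ (𝓞 K) x) =
        ∏ g : K ≃ₐ[ℚ] K, g • x := by
      apply RingOfIntegers.coe_injective
      rw [← IsScalarTower.algebraMap_apply ℤ (𝓞 K) K, IsScalarTower.algebraMap_apply ℤ ℚ K,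
        Algebra.algebraMap_intNorm (K := ℚ) (L := K), Algebra.norm_eq_prod_automorphisms, map_prod]
      rfl
    rw [Function.comp_apply, hprod]
    exact Ideal.prod_mem_prod fun g _ ↦ Ideal.smul_mem_pointwise_smul g x I hx
  obtain ⟨C, hC⟩ := Ideal.dvd_iff_le.2 hle
  have hnorm := congrArg Ideal.absNorm hC
  have hcard : Fintype.card (K ≃ₐ[ℚ] K) = Module.finrank ℤ (𝓞 K) := by
    rw [RingOfIntegers.rank, ← Nat.card_eq_fintype_card, IsGalois.card_aut_eq_finrank]
  rw [map_mul, map_prod, Ideal.absNorm_span_natCast] at hnorm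
  simp only [Ideal.absNorm_galois_smul, Finset.prod_const, Finset.card_univ, hcard] at hnorm
  have hC1 : C.absNorm = 1 := by
    refine (Nat.eq_of_mul_eq_mul_left (Nat.pos_of_ne_zero ?_) ((mul_one _).trans hnorm)).symm
    exact pow_ne_zero _ fun h ↦ hI (Ideal.absNorm_eq_zero_iff.1 h)
  rw [hC, Ideal.absNorm_eq_one_iff.1 hC1, Ideal.mul_top]

theorem exists_mulEquiv_pi_zmod_two {G : Type*} [CommGroup G] [Finite G]
    (h : ∀ x : G, x ^ 2 = 1) :
    ∃ s : ℕ, Nonempty (G ≃* (Fin s → Multiplicative (ZMod 2))) := by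
  let : Module (ZMod 2) (Additive G) := AddCommGroup.zmodModule fun x ↦ h x.toMul
  let e := (Module.finBasis (ZMod 2) (Additive G)).equivFun
  exact ⟨_, ⟨
    { toFun x i := .ofAdd (e (.ofMul x) i)
      invFun v := (e.symm fun i ↦ (v i).toAdd).toMul
      left_inv x := by simp
      right_inv v := by simp
      map_mul' x y := by ext; simp }⟩⟩

theorem MonoidHom.apply_eq_one_of_not_dvd_card {G A : Type*} [Group G] [Group A] [Finite A]
    (φ : G →* A) {p : ℕ} (hp : p.Prime) (hA : ¬ p ∣ Nat.card A) {g : G} (hg : g ^ p = 1) :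
    φ g = 1 := by
  have h := pow_gcd_eq_one.2 ⟨(by rw [← map_pow, hg, map_one] : φ g ^ p = 1),
    pow_card_eq_one' (x := φ g)⟩
  rwa [(Nat.Prime.coprime_iff_not_dvd hp).2 hA, pow_one] at h

theorem Ideal.smul_map_eq_of_mem_fixingSubgroup {K : Type*} [Field K] [NumberField K]
    (F : IntermediateField ℚ K) {g : K ≃ₐ[ℚ] K} (hg : g ∈ F.fixingSubgroup) (I : Ideal (𝓞 F)) :
    g • I.map (algebraMap (𝓞 F) (𝓞 K)) = I.map (algebraMap (𝓞 F) (𝓞 K)) := by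
  rw [Ideal.pointwise_smul_def, Ideal.map_map]
  congr 1
  ext x
  exact (IntermediateField.mem_fixingSubgroup_iff F g).1 hg _ (x : F).2

/-- A class that capitulates in an extension is killed by the degree of the extension. -/
theorem ClassGroup.mk0_pow_finrank_eq_one {R S : Type*} [CommRing R]
    [IsDedekindDomain R] [CommRing S] [IsDedekindDomain S] [Algebra R S] [Module.Finite R S]
    [Module.IsTorsionFree R S] (I : (Ideal R)⁰)
    (h : ((I : Ideal R).map (algebraMap R S)).IsPrincipal) :
    ClassGroup.mk0 I ^ Module.finrank R S = 1 := by
  obtain ⟨a, ha⟩ := h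
  rw [← map_pow, ← Subtype.coe_eta (I ^ Module.finrank R S) (Subtype.prop _),
    ClassGroup.mk0_eq_one_iff, SubmonoidClass.coe_pow, ← Ideal.relNorm_algebraMap S, ha]
  refine ⟨Algebra.intNorm R S a, ?_⟩
  exact Ideal.relNorm_singleton R a

theorem statement8 (K : Type*) [Field K] [NumberField K] [IsGalois ℚ K]
    (hcyc : IsCyclic (K ≃ₐ[ℚ] K)) (hdeg : Module.finrank ℚ K = 6)
    (F : IntermediateField ℚ K) (hF : Module.finrank ℚ F = 3)
    (hcop : Nat.Coprime (classNumber K) 6)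
    (h3 : ¬ (3 ∣ Nat.card (MulAut (ClassGroup (𝓞 K))))) :
    Monoid.exponent (ClassGroup (𝓞 F)) ≤ 2 ∧
    ∃ s : ℕ, Nonempty (ClassGroup (𝓞 F) ≃* (Fin s → Multiplicative (ZMod 2))) := by
  have hFK : Module.finrank F K = 2 := by
    have := Module.finrank_mul_finrank ℚ F K
    rw [hF, hdeg] at this
    omega
  have hrank : Module.finrank (𝓞 F) (𝓞 K) = 2 := by
    rw [← hFK]
    exact (IsFractionRing.finrank_eq (𝓞 F) F (𝓞 K) K).symm
  have hcard : Nat.card (K ≃ₐ[ℚ] K) = 6 := by rw [IsGalois.card_aut_eq_finrank, hdeg]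
  have hindex : F.fixingSubgroup.index = 3 := by
    have := F.fixingSubgroup.card_mul_index
    rw [IsGalois.card_fixingSubgroup_eq_finrank, hFK, hcard] at this
    omega
  let : CommGroup (K ≃ₐ[ℚ] K) := IsCyclic.commGroup
  obtain ⟨φ, hφ⟩ := ClassGroup.exists_hom_mulAut (K ≃ₐ[ℚ] K) (𝓞 K)
  have hsq (x : ClassGroup (𝓞 F)) : x ^ 2 = 1 := by
    obtain ⟨I, rfl⟩ := ClassGroup.mk0_surjective x
    set J := ClassGroup.extendedIdeal (𝓞 F) (𝓞 K) I
    have hfix (g : K ≃ₐ[ℚ] K) : φ g (ClassGroup.mk0 J) = ClassGroup.mk0 J := by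
      have h6 : g ^ 6 = 1 := hcard ▸ pow_card_eq_one'
      have h2 : φ (g ^ 2) = 1 :=
        φ.apply_eq_one_of_not_dvd_card Nat.prime_three h3 (by rw [← pow_mul, h6])
      have hmem : g ^ 3 ∈ F.fixingSubgroup := hindex ▸ F.fixingSubgroup.pow_index_mem g
      have h := hφ (g ^ 3) J J (Ideal.smul_map_eq_of_mem_fixingSubgroup F hmem I)
      rwa [pow_succ, map_mul, h2, one_mul] at h
    have hpow : ClassGroup.mk0 J ^ 6 = 1 := by
      have hprod : ∏ g : K ≃ₐ[ℚ] K, φ g (ClassGroup.mk0 J) = 1 := by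
        simp_rw [fun g ↦ hφ g J ⟨_, Ideal.smul_mem_nonZeroDivisors g J⟩ rfl, ← map_prod]
        rw [← Subtype.coe_eta (∏ g : K ≃ₐ[ℚ] K, _) (Subtype.prop _), ClassGroup.mk0_eq_one_iff,
          Submonoid.coe_finsetProd, Ideal.prod_galois_smul _ (nonZeroDivisors.coe_ne_zero J)]
        exact ⟨_, rfl⟩
      simpa [hfix, ← Nat.card_eq_fintype_card, hcard] using hprod
    have hone : ClassGroup.mk0 J = 1 := by
      have h := pow_gcd_eq_one.2 ⟨pow_card_eq_one (x := ClassGroup.mk0 J), hpow⟩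
      rwa [← classNumber, hcop, pow_one] at h
    rw [← hrank]
    exact ClassGroup.mk0_pow_finrank_eq_one I ((ClassGroup.mk0_eq_one_iff J.2).1 hone)
  exact ⟨Monoid.exponent_min' 2 two_pos hsq, exists_mulEquiv_pi_zmod_two hsq⟩
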